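/- If the sensing cost is zero (s = 0), then c₁(r) ≤ c₀(r) for every r ∈ [0,1]; that is, measuring is never worse than not measuring. -/

import Mathlib

noncomputable section

/-- The piecewise function `t(r) = r` if `r < 1/2`, else `1 - r`. -/
def tfun (r : ℝ) : ℝ := if r < 1/2 then r else 1 - r

/-- No-measurement cost `c₀(r) = (c²/2)·t(r)`. -/
def costNoMeasure (c r : ℝ) : ℝ := c^2 / 2 * tfun r

/-- Measurement cost `c₁(r) = (c²/2)·t(r(1−p_D)/(1−r·p_D))·(1−r·p_D) + s`.
(When `r = p_D = 1`, the first summand is `0`, consistent with this formula.) -/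
def costMeasure (c pD s r : ℝ) : ℝ :=
  c^2 / 2 * tfun (r * (1 - pD) / (1 - r * pD)) * (1 - r * pD) + s

theorem tfun_eq_min (r : ℝ) : tfun r = min r (1 - r) := by
  unfold tfun
  split_ifs with h
  · exact (min_eq_left (by linarith)).symm
  · exact (min_eq_right (by linarith)).symm

theorem tfun_div_mul {x m : ℝ} (hm : 0 < m) : tfun (x / m) * m = min x (m - x) := by
  rw [tfun_eq_min, min_mul_of_nonneg _ _ hm.le, sub_mul, div_mul_cancel₀ _ hm.ne', one_mul]

/-- If the sensing cost is zero, measuring is never worse than not measuring. -/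
theorem measure_le_of_zero_cost (c pD r : ℝ) (hc : 0 < c) (hpD0 : 0 < pD) (hpD1 : pD ≤ 1)
    (hr0 : 0 ≤ r) (hr1 : r ≤ 1) :
    costMeasure c pD 0 r ≤ costNoMeasure c r := by
  unfold costMeasure costNoMeasure
  rw [add_zero, mul_assoc]
  refine mul_le_mul_of_nonneg_left ?_ (by positivity)
  have hm : 0 ≤ 1 - r * pD := sub_nonneg.2 (mul_le_one₀ hr1 hpD0.le hpD1)
  rcases hm.eq_or_lt with hm | hm
  · rw [← hm, mul_zero, tfun_eq_min]
    exact le_min hr0 (sub_nonneg.2 hr1)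
  · rw [tfun_div_mul hm, tfun_eq_min]
    exact min_le_min (mul_le_of_le_one_right hr0 (by linarith)) (by linarith)
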